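/- Let X be a complex Hilbert space and (Y_1,…,Y_d) a d-fold positive decomposition of the identity on X. Then there exist a complex Hilbert space X̃, a d-fold spectral decomposition (P_1,…,P_d) of the identity on X̃, and an isometric bounded linear map ι : X → X̃ such that Y_k = ι* ∘ P_k ∘ ι for every k = 1,…,d. (One may take X̃ to be the Hilbert-space direct sum of d copies of X, ι the column with k-th entry the positive square root of Y_k, and P_k the orthogonal projection onto the k-th summand.) -/

import Mathlib

/-- The column operator `x ↦ (A i x)ᵢ` into the Hilbert-space direct sum. -/
noncomputable def columnOperator {ι 𝕜 X Z : Type*} [Fintype ι] [RCLike 𝕜]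
    [NormedAddCommGroup X] [InnerProductSpace 𝕜 X] [NormedAddCommGroup Z] [InnerProductSpace 𝕜 Z]
    (A : ι → Z →L[𝕜] X) : Z →L[𝕜] PiLp 2 (fun _ : ι => X) :=
  ((PiLp.continuousLinearEquiv 2 𝕜 (fun _ : ι => X)).symm :
    (ι → X) →L[𝕜] PiLp 2 (fun _ : ι => X)) ∘L ContinuousLinearMap.pi A

@[simp]
theorem columnOperator_apply {ι 𝕜 X Z : Type*} [Fintype ι] [RCLike 𝕜]
    [NormedAddCommGroup X] [InnerProductSpace 𝕜 X] [NormedAddCommGroup Z] [InnerProductSpace 𝕜 Z]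
    (A : ι → Z →L[𝕜] X) (z : Z) (i : ι) : columnOperator A z i = A i z :=
  rfl

/-- The projection of the direct sum of copies of `X` onto the `k`-th summand. -/
noncomputable def summandProjection {ι : Type*} (𝕜 X : Type*) [Fintype ι] [DecidableEq ι]
    [RCLike 𝕜] [NormedAddCommGroup X] [InnerProductSpace 𝕜 X] (k : ι) :
    PiLp 2 (fun _ : ι => X) →L[𝕜] PiLp 2 (fun _ : ι => X) :=
  columnOperator fun i => if i = k then PiLp.proj 2 (fun _ : ι => X) i else 0

@[simp]
theorem summandProjection_apply {ι 𝕜 X : Type*} [Fintype ι] [DecidableEq ι]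
    [RCLike 𝕜] [NormedAddCommGroup X] [InnerProductSpace 𝕜 X] (k : ι)
    (v : PiLp 2 (fun _ : ι => X)) (i : ι) :
    summandProjection 𝕜 X k v i = if i = k then v i else 0 := by
  by_cases h : i = k <;> simp [summandProjection, h]

/-- A positive operator is the square of a selfadjoint operator. -/
theorem ContinuousLinearMap.IsPositive.exists_isSelfAdjoint_mul_self {X : Type*}
    [NormedAddCommGroup X] [InnerProductSpace ℂ X] [CompleteSpace X] {A : X →L[ℂ] X}
    (hA : A.IsPositive) : ∃ S : X →L[ℂ] X, IsSelfAdjoint S ∧ S * S = A :=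
  ⟨CFC.sqrt A, IsSelfAdjoint.of_nonneg (CFC.sqrt_nonneg A),
    CFC.sqrt_mul_sqrt_self A ((ContinuousLinearMap.nonneg_iff_isPositive A).2 hA)⟩


/-- **Naimark dilation of a positive decomposition of the identity.**
If `(Y 0, …, Y (d-1))` is a `d`-fold positive decomposition of the identity on a complex
Hilbert space `X` (each `Y k` is a selfadjoint operator with `0 ≤ Y k ≤ 1` and
`∑ k, Y k = 1`), then there exist a complex Hilbert space `X'`, a `d`-fold spectral
decomposition `(P 0, …, P (d-1))` of the identity on `X'` (orthogonal projections summing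
to the identity), and an isometric bounded linear map `ι : X → X'` such that
`Y k = ι* ∘ P k ∘ ι` for every `k`. -/
theorem positive_decomposition_dilates_to_spectral_decomposition.{u}
    {X : Type u} [NormedAddCommGroup X] [InnerProductSpace ℂ X] [CompleteSpace X]
    (d : ℕ) (Y : Fin d → X →L[ℂ] X)
    (hY_pos : ∀ k, (Y k).IsPositive)
    (hY_contr : ∀ k, ((1 : X →L[ℂ] X) - Y k).IsPositive)
    (hY_sum : ∑ k, Y k = 1) :
    ∃ (X' : Type u) (_ : NormedAddCommGroup X') (_ : InnerProductSpace ℂ X')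
      (_ : CompleteSpace X') (P : Fin d → X' →L[ℂ] X') (ι : X →L[ℂ] X'),
      (∀ k, IsSelfAdjoint (P k)) ∧ (∀ k, IsIdempotentElem (P k)) ∧ (∑ k, P k = 1) ∧
      Isometry ι ∧
      (∀ k, Y k = ContinuousLinearMap.adjoint ι ∘L P k ∘L ι) := by
  choose S hS hSS using fun k => (hY_pos k).exists_isSelfAdjoint_mul_self
  have hinner (k : Fin d) (x y : X) : inner ℂ (S k x) (S k y) = inner ℂ x (Y k y) := by
    rw [← hSS k]
    exact (ContinuousLinearMap.isSelfAdjoint_iff_isSymmetric.1 (hS k)) x (S k y)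
  refine ⟨PiLp 2 (fun _ : Fin d => X), inferInstance, inferInstance, inferInstance,
    summandProjection ℂ X, columnOperator S, fun k => ?_, fun k => ?_, ?_, ?_, fun k => ?_⟩
  · rw [ContinuousLinearMap.isSelfAdjoint_iff_isSymmetric]
    intro v w
    simp only [ContinuousLinearMap.coe_coe, PiLp.inner_apply, summandProjection_apply]
    refine Finset.sum_congr rfl fun i _ => ?_
    split_ifs <;> simp
  · ext v i
    simp +contextual
  · ext v i
    simp
  · refine AddMonoidHomClass.isometry_of_norm _ fun x => ?_
    have h : inner ℂ (columnOperator S x) (columnOperator S x) = inner ℂ x x := by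
      simp only [PiLp.inner_apply, columnOperator_apply, hinner]
      rw [← inner_sum, ← sum_apply, hY_sum]
      rfl
    rw [@norm_eq_sqrt_re_inner ℂ, h, ← @norm_eq_sqrt_re_inner ℂ]
  · ext y
    refine ext_inner_left ℂ fun x => ?_
    rw [ContinuousLinearMap.comp_apply, ContinuousLinearMap.adjoint_inner_right, PiLp.inner_apply]
    simp [apply_ite, hinner]
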